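/- Let f : [0,∞) → (0,1] be monotone non-increasing with f(0) = 1, and suppose u ↦ u·f(u) is monotone non-decreasing on [0,∞) with u·f(u) ≤ 1 for all u ≥ 0. Let τ be real with 2 < τ < 3 and let 0 < a < b. Define R_f(a,b,τ) = (∫_a^b ∫_a^b f(x·y) (x·y)^(2−τ) dx dy) / (∫_a^b x^(1−τ) dx)^2 and R_max(a,b,τ) the same expression with f replaced by f_max(u) = min(1, 1/u). Then f(1)·R_max(a,b,τ) ≤ R_f(a,b,τ) ≤ R_max(a,b,τ). -/

import Mathlib

open MeasureTheory Set

/-- A function of the product that is antitone on the positive reals is integrable in each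
variable. -/
lemma intervalIntegrable_comp_mul {g : ℝ → ℝ} (hg : AntitoneOn g (Ioi 0)) {a b x : ℝ}
    (ha : 0 < a) (hab : a ≤ b) (hx : 0 < x) :
    IntervalIntegrable (fun y => g (x * y)) volume a b := by
  apply AntitoneOn.intervalIntegrable
  rw [uIcc_of_le hab]
  intro y hy z hz hyz
  exact hg (mul_pos hx (ha.trans_le hy.1)) (mul_pos hx (ha.trans_le hz.1))
    (mul_le_mul_of_nonneg_left hyz hx.le)

lemma intervalIntegrable_integral_comp_mul {g : ℝ → ℝ} (hg : AntitoneOn g (Ioi 0)) {a b : ℝ}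
    (ha : 0 < a) (hab : a ≤ b) :
    IntervalIntegrable (fun x => ∫ y in a..b, g (x * y)) volume a b := by
  apply AntitoneOn.intervalIntegrable
  rw [uIcc_of_le hab]
  intro x hx z hz hxz
  have hx0 : 0 < x := ha.trans_le hx.1
  have hz0 : 0 < z := ha.trans_le hz.1
  refine intervalIntegral.integral_mono_on hab (intervalIntegrable_comp_mul hg ha hab hz0)
    (intervalIntegrable_comp_mul hg ha hab hx0) fun y hy => ?_
  have hy0 : 0 < y := ha.trans_le hy.1
  exact hg (mul_pos hx0 hy0) (mul_pos hz0 hy0) (mul_le_mul_of_nonneg_right hxz hy0.le)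

lemma integral_integral_comp_mul_mono {g h : ℝ → ℝ} (hg : AntitoneOn g (Ioi 0))
    (hh : AntitoneOn h (Ioi 0)) (hgh : ∀ u, 0 < u → g u ≤ h u) {a b : ℝ}
    (ha : 0 < a) (hab : a ≤ b) :
    ∫ x in a..b, ∫ y in a..b, g (x * y) ≤ ∫ x in a..b, ∫ y in a..b, h (x * y) := by
  refine intervalIntegral.integral_mono_on hab (intervalIntegrable_integral_comp_mul hg ha hab)
    (intervalIntegrable_integral_comp_mul hh ha hab) fun x hx => ?_
  have hx0 : 0 < x := ha.trans_le hx.1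
  exact intervalIntegral.integral_mono_on hab (intervalIntegrable_comp_mul hg ha hab hx0)
    (intervalIntegrable_comp_mul hh ha hab hx0)
    fun y hy => hgh _ (mul_pos hx0 (ha.trans_le hy.1))

lemma AntitoneOn.mul_rpow_of_nonpos {g : ℝ → ℝ} (hg : AntitoneOn g (Ioi 0))
    (hg0 : ∀ u, 0 < u → 0 ≤ g u) {s : ℝ} (hs : s ≤ 0) :
    AntitoneOn (fun u => g u * u ^ s) (Ioi 0) := by
  intro u hu v hv huv
  exact mul_le_mul (hg hu hv huv) (Real.rpow_le_rpow_of_nonpos hu huv hs)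
    (Real.rpow_nonneg (le_of_lt hv) s) (hg0 u hu)

lemma antitoneOn_min_one_one_div : AntitoneOn (fun u : ℝ => min 1 (1 / u)) (Ioi 0) := by
  intro u hu v _ huv
  exact min_le_min_left 1 (one_div_le_one_div_of_le hu huv)

theorem clustering_sandwich_bounds
    (f : ℝ → ℝ)
    (hfpos : ∀ u ∈ Ici (0:ℝ), 0 < f u)
    (hfle : ∀ u ∈ Ici (0:ℝ), f u ≤ 1)
    (hf0 : f 0 = 1)
    (hF1 : AntitoneOn f (Ici 0))
    (hF2 : MonotoneOn (fun u => u * f u) (Ici 0))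
    (hr : ∀ u ∈ Ici (0:ℝ), u * f u ≤ 1)
    (τ a b : ℝ) (hτ2 : 2 < τ) (hτ3 : τ < 3) (ha : 0 < a) (hab : a < b)
    (Rf Rmax : ℝ)
    (hRf : Rf = (∫ x in a..b, ∫ y in a..b, f (x * y) * (x * y) ^ (2 - τ)) /
        (∫ x in a..b, x ^ (1 - τ)) ^ 2)
    (hRmax : Rmax =
      (∫ x in a..b, ∫ y in a..b, min 1 (1 / (x * y)) * (x * y) ^ (2 - τ)) /
        (∫ x in a..b, x ^ (1 - τ)) ^ 2) :
    f 1 * Rmax ≤ Rf ∧ Rf ≤ Rmax := by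
  have hs : 2 - τ ≤ 0 := by linarith
  have hf := AntitoneOn.mul_rpow_of_nonpos (hF1.mono Ioi_subset_Ici_self)
    (fun u hu => (hfpos u hu.le).le) hs
  have hmax := AntitoneOn.mul_rpow_of_nonpos antitoneOn_min_one_one_div
    (fun u hu => le_min zero_le_one (one_div_pos.2 hu).le) hs
  have one_mem : (1 : ℝ) ∈ Ici (0 : ℝ) := mem_Ici.2 zero_le_one
  have hf1 : 0 < f 1 := hfpos 1 one_mem
  have hcmax : AntitoneOn (fun u : ℝ => f 1 * (min 1 (1 / u) * u ^ (2 - τ))) (Ioi 0) :=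
    fun u hu v hv huv => mul_le_mul_of_nonneg_left (hmax hu hv huv) hf1.le
  have lower : ∀ u, 0 < u → f 1 * min 1 (1 / u) ≤ f u := by
    intro u hu
    rcases le_total u 1 with h | h
    · exact (mul_le_of_le_one_right hf1.le (min_le_left _ _)).trans
        (hF1 hu.le one_mem h)
    · have h1 : 1 * f 1 ≤ u * f u := hF2 one_mem hu.le h
      calc f 1 * min 1 (1 / u) ≤ f 1 * (1 / u) :=
            mul_le_mul_of_nonneg_left (min_le_right _ _) hf1.le
        _ ≤ f u := by
            rw [mul_one_div, div_le_iff₀ hu]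
            linarith
  have upper : ∀ u, 0 < u → f u ≤ min 1 (1 / u) := by
    intro u hu
    refine le_min (hfle u hu.le) ?_
    rw [le_div_iff₀ hu, mul_comm]
    exact hr u hu.le
  rw [hRf, hRmax]
  constructor
  · rw [← mul_div_assoc]
    refine div_le_div_of_nonneg_right ?_ (sq_nonneg _)
    have key := integral_integral_comp_mul_mono hcmax hf (fun u hu => by
      rw [← mul_assoc]
      exact mul_le_mul_of_nonneg_right (lower u hu) (Real.rpow_nonneg hu.le _)) ha hab.le
    simpa only [intervalIntegral.integral_const_mul] using key
  · exact div_le_div_of_nonneg_right (integral_integral_comp_mul_mono hf hmax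
      (fun u hu => mul_le_mul_of_nonneg_right (upper u hu) (Real.rpow_nonneg hu.le _))
      ha hab.le) (sq_nonneg _)
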